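/- Let K be a field of characteristic zero, R = K[x,y,z], and let a, b, α, β, γ be integers with a ≥ 3, a ≤ 2b−2, 1 ≤ α ≤ a−1, 1 ≤ γ ≤ 2, α + γ = b, and a−b+1 ≤ β ≤ b−1. Then the quotient of R by the ideal I_β = (x^a, y^b − x^α z^γ, z^3, x^{a−α} y^{b−β}, y^{b−β} z^{3−γ}) has the weak Lefschetz property. -/

import Mathlib

open MvPolynomial

/-- The degree-`i` graded component of `R/I`, i.e. the image in `R/I` of the
space of homogeneous polynomials of degree `i`. -/
noncomputable def grComponent (K : Type*) [Field K]
    (I : Ideal (MvPolynomial (Fin 3) K)) (i : ℕ) :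
    Submodule K (MvPolynomial (Fin 3) K ⧸ I) :=
  (MvPolynomial.homogeneousSubmodule (Fin 3) K i).map
    (Ideal.Quotient.mkₐ K I).toLinearMap

/-- The Hilbert function of `R/I`. -/
noncomputable def hilb (K : Type*) [Field K]
    (I : Ideal (MvPolynomial (Fin 3) K)) (i : ℕ) : ℕ :=
  Module.finrank K (grComponent K I i)

/-- `R/I` has the weak Lefschetz property: there is a linear form `L` such that
for every `i`, multiplication by `L` from `[R/I]_i` to `[R/I]_{i+1}` is
injective or surjective. -/
def hasWLP (K : Type*) [Field K] (I : Ideal (MvPolynomial (Fin 3) K)) : Prop :=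
  ∃ L : MvPolynomial (Fin 3) K, L.IsHomogeneous 1 ∧
    ∀ i : ℕ,
      (∀ u ∈ grComponent K I i, ∀ v ∈ grComponent K I i,
          Ideal.Quotient.mk I L * u = Ideal.Quotient.mk I L * v → u = v) ∨
      (∀ w ∈ grComponent K I (i + 1), ∃ u ∈ grComponent K I i,
          Ideal.Quotient.mk I L * u = w)

/-- The monomial `x ^ i * y ^ j * z ^ k`. -/
noncomputable def mon (K : Type*) [Field K] (i j k : ℕ) : MvPolynomial (Fin 3) K :=
  X 0 ^ i * X 1 ^ j * X 2 ^ k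

section Monomials

variable {K : Type*} [Field K]

theorem mon_mul (i j k i' j' k' : ℕ) :
    mon K i j k * mon K i' j' k' = mon K (i + i') (j + j') (k + k') := by
  simp only [mon]; ring

theorem monomial_eq_smul_mon (s : Fin 3 →₀ ℕ) (c : K) :
    monomial s c = c • mon K (s 0) (s 1) (s 2) := by
  rw [monomial_eq, Finsupp.prod_fintype _ _ (fun _ => pow_zero _), Fin.prod_univ_three,
    smul_eq_C_mul, mon]

theorem mem_of_mon_mem (S : Submodule K (MvPolynomial (Fin 3) K))
    (h : ∀ i j k, mon K i j k ∈ S) (f : MvPolynomial (Fin 3) K) : f ∈ S := by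
  induction f using MvPolynomial.induction_on' with
  | monomial s c => rw [monomial_eq_smul_mon]; exact S.smul_mem _ (h _ _ _)
  | add p q hp hq => exact S.add_mem hp hq

theorem isHomogeneous_mon (i j k : ℕ) : (mon K i j k).IsHomogeneous (i + j + k) :=
  ((isHomogeneous_X_pow _ _).mul (isHomogeneous_X_pow _ _)).mul (isHomogeneous_X_pow _ _)

end Monomials

/-- The exponents of the monomials equivalent to the socle generator
`x ^ (a - 1) * y ^ (n - 1) * z ^ 2` modulo `y ^ b - x ^ α * z ^ γ`. -/
def IsSocleExponent (a b α γ n i j k : ℕ) : Prop :=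
  (j + 1 = n ∧ i + 1 = a ∧ k = 2) ∨ (j + 1 = b + n ∧ i + α + 1 = a ∧ k + γ = 2) ∨
    (j + 1 = 2 * b + n ∧ i + 2 * α + 1 = a ∧ k + 2 * γ = 2)

open Classical in
/-- The dual socle generator, as a functional on polynomials. -/
noncomputable def socleForm (K : Type*) [Field K] (a b α γ n : ℕ) :
    MvPolynomial (Fin 3) K →ₗ[K] K :=
  (basisMonomials (Fin 3) K).constr K
    (fun s => if IsSocleExponent a b α γ n (s 0) (s 1) (s 2) then 1 else 0)

/-- The ideal `(x^a, y^b - x^α z^γ, z^3, x^(a-α) y^n, y^n z^(3-γ))`. -/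
noncomputable def gorIdeal (K : Type*) [Field K] (a b α γ n : ℕ) :
    Ideal (MvPolynomial (Fin 3) K) :=
  Ideal.span {(X 0 : MvPolynomial (Fin 3) K) ^ a,
      X 1 ^ b - X 0 ^ α * X 2 ^ γ, X 2 ^ 3,
      X 0 ^ (a - α) * X 1 ^ n, X 1 ^ n * X 2 ^ (3 - γ)}

section Duality

variable {K : Type*} [Field K] {a b α γ n : ℕ}

open Classical in
theorem socleForm_monomial (s : Fin 3 →₀ ℕ) (c : K) :
    socleForm K a b α γ n (monomial s c) =
      if IsSocleExponent a b α γ n (s 0) (s 1) (s 2) then c else 0 := by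
  have h : monomial s c = c • (basisMonomials (Fin 3) K s) := by
    simp [coe_basisMonomials, smul_monomial]
  rw [h, map_smul, socleForm, Module.Basis.constr_basis]
  simp

open Classical in
theorem socleForm_mon (i j k : ℕ) :
    socleForm K a b α γ n (mon K i j k) =
      if IsSocleExponent a b α γ n i j k then 1 else 0 := by
  have h := monomial_eq_smul_mon (K := K)
    (Finsupp.single 0 i + Finsupp.single 1 j + Finsupp.single 2 k) 1
  have e0 : (Finsupp.single 0 i + Finsupp.single 1 j + Finsupp.single 2 k : Fin 3 →₀ ℕ) 0 = i := by
    simp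
  have e1 : (Finsupp.single 0 i + Finsupp.single 1 j + Finsupp.single 2 k : Fin 3 →₀ ℕ) 1 = j := by
    simp
  have e2 : (Finsupp.single 0 i + Finsupp.single 1 j + Finsupp.single 2 k : Fin 3 →₀ ℕ) 2 = k := by
    simp
  rw [e0, e1, e2, one_smul] at h
  rw [← h, socleForm_monomial, e0, e1, e2]

theorem socleForm_eq_zero_of_isHomogeneous (hαγ : α + γ = b) {D : ℕ} (hD : D ≠ a + n)
    {f : MvPolynomial (Fin 3) K} (hf : f.IsHomogeneous D) :
    socleForm K a b α γ n f = 0 := by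
  rw [← f.support_sum_monomial_coeff, map_sum]
  refine Finset.sum_eq_zero fun s hs => ?_
  rw [socleForm_monomial, if_neg]
  have h := hf (mem_support_iff.mp hs)
  change Finsupp.weight (fun _ => 1) s = D at h
  rw [← Finsupp.degree_eq_weight_one, Finsupp.degree_eq_sum, Fin.sum_univ_three] at h
  unfold IsSocleExponent
  omega

theorem mon_mem_gorIdeal {i j k : ℕ}
    (h : a ≤ i ∨ 3 ≤ k ∨ (n ≤ j ∧ (a ≤ i + α ∨ 3 ≤ k + γ))) :
    mon K i j k ∈ gorIdeal K a b α γ n := by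
  have key (f : MvPolynomial (Fin 3) K) (hf : f ∈ ({(X 0 : MvPolynomial (Fin 3) K) ^ a,
      X 1 ^ b - X 0 ^ α * X 2 ^ γ, X 2 ^ 3,
      X 0 ^ (a - α) * X 1 ^ n, X 1 ^ n * X 2 ^ (3 - γ)} : Set (MvPolynomial (Fin 3) K)))
      (hd : f ∣ mon K i j k) : mon K i j k ∈ gorIdeal K a b α γ n :=
    Ideal.mem_of_dvd _ hd (Ideal.subset_span hf)
  rcases h with h | h | ⟨hj, h | h⟩
  · exact key (X 0 ^ a) (by simp)
      (((pow_dvd_pow _ h).mul_right _).mul_right _)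
  · exact key (X 2 ^ 3) (by simp) ((pow_dvd_pow _ h).mul_left _)
  · exact key (X 0 ^ (a - α) * X 1 ^ n) (by simp)
      ((mul_dvd_mul (pow_dvd_pow _ (by omega)) (pow_dvd_pow _ hj)).mul_right _)
  · refine key (X 1 ^ n * X 2 ^ (3 - γ)) (by simp) ?_
    rw [mon, mul_assoc]
    exact (mul_dvd_mul (pow_dvd_pow _ hj) (pow_dvd_pow _ (by omega))).mul_left _

theorem mon_sub_mon_mem_gorIdeal {i j k : ℕ} (h : b ≤ j) :
    mon K i j k - mon K (i + α) (j - b) (k + γ) ∈ gorIdeal K a b α γ n := by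
  obtain ⟨l, rfl⟩ := Nat.exists_eq_add_of_le h
  have : mon K i (b + l) k - mon K (i + α) (b + l - b) (k + γ) =
      mon K i l k * (X 1 ^ b - X 0 ^ α * X 2 ^ γ) := by
    simp only [mon, Nat.add_sub_cancel_left]; ring
  rw [this]
  exact Ideal.mul_mem_left _ _ (Ideal.subset_span (by simp))

theorem socleForm_mul_eq_zero (hγ : 1 ≤ γ) (hn : 1 ≤ n) (hnb : n ≤ b)
    {f : MvPolynomial (Fin 3) K} (hf : f ∈ gorIdeal K a b α γ n) (g : MvPolynomial (Fin 3) K) :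
    socleForm K a b α γ n (f * g) = 0 := by
  have key (p : MvPolynomial (Fin 3) K)
      (h : ∀ i j k, socleForm K a b α γ n (p * mon K i j k) = 0) (g : MvPolynomial (Fin 3) K) :
      socleForm K a b α γ n (p * g) = 0 :=
    mem_of_mon_mem (LinearMap.ker (socleForm K a b α γ n ∘ₗ LinearMap.mulLeft K p)) h g
  induction hf using Submodule.span_induction generalizing g with
  | zero => simp
  | add x y _ _ hx hy => rw [add_mul, map_add, hx, hy, add_zero]
  | smul c x _ hx => rw [smul_eq_mul, mul_comm c, mul_assoc]; exact hx _
  | mem x hx =>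
    refine key x (fun i j k => ?_) g
    simp only [Set.mem_insert_iff, Set.mem_singleton_iff] at hx
    rcases hx with rfl | rfl | rfl | rfl | rfl
    · have : (X 0 : MvPolynomial (Fin 3) K) ^ a = mon K a 0 0 := by simp [mon]
      rw [this, mon_mul, socleForm_mon, if_neg]
      unfold IsSocleExponent; omega
    · have : (X 1 : MvPolynomial (Fin 3) K) ^ b - X 0 ^ α * X 2 ^ γ =
          mon K 0 b 0 - mon K α 0 γ := by simp [mon]
      rw [this, sub_mul, mon_mul, mon_mul, map_sub, socleForm_mon, socleForm_mon, sub_eq_zero]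
      congr 1
      unfold IsSocleExponent
      rw [eq_iff_iff]
      omega
    · have : (X 2 : MvPolynomial (Fin 3) K) ^ 3 = mon K 0 0 3 := by simp [mon]
      rw [this, mon_mul, socleForm_mon, if_neg]
      unfold IsSocleExponent; omega
    · have : (X 0 : MvPolynomial (Fin 3) K) ^ (a - α) * X 1 ^ n = mon K (a - α) n 0 := by
        simp [mon]
      rw [this, mon_mul, socleForm_mon, if_neg]
      unfold IsSocleExponent; omega
    · have : (X 1 : MvPolynomial (Fin 3) K) ^ n * X 2 ^ (3 - γ) = mon K 0 n (3 - γ) := by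
        simp [mon]
      rw [this, mon_mul, socleForm_mon, if_neg]
      unfold IsSocleExponent; omega

/-- The monomial dual, under `socleForm`, to a standard monomial modulo `gorIdeal`. -/
noncomputable def dualMon (K : Type*) [Field K] (a b α γ n i j k : ℕ) : MvPolynomial (Fin 3) K :=
  if j < n then mon K (a - 1 - i) (n - 1 - j) (2 - k)
  else mon K (a - 1 - α - i) (b + n - 1 - j) (2 - γ - k)

/-- The exponents of the standard monomials modulo `gorIdeal`. -/
def standardExponents (a b α γ n : ℕ) : Finset (ℕ × ℕ × ℕ) :=
  (Finset.range a ×ˢ Finset.range b ×ˢ Finset.range 3).filter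
    fun s => s.2.1 < n ∨ (s.1 + α < a ∧ s.2.2 + γ < 3)

theorem mem_gorIdeal_of_socleForm_eq_zero (hα : 1 ≤ α) (hγ : 1 ≤ γ) (hγ2 : γ ≤ 2)
    (hn : 1 ≤ n) (hnb : n ≤ b)
    {f : MvPolynomial (Fin 3) K} (hf : ∀ i j k, socleForm K a b α γ n (f * mon K i j k) = 0) :
    f ∈ gorIdeal K a b α γ n := by
  classical
  have hdual : ∀ i j k, socleForm K a b α γ n (f * dualMon K a b α γ n i j k) = 0 := by
    intro i j k; unfold dualMon; split_ifs <;> exact hf _ _ _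
  let T : MvPolynomial (Fin 3) K →ₗ[K] MvPolynomial (Fin 3) K :=
    LinearMap.id - ∑ s ∈ standardExponents a b α γ n,
      (socleForm K a b α γ n ∘ₗ LinearMap.mulRight K
        (dualMon K a b α γ n s.1 s.2.1 s.2.2)).smulRight (mon K s.1 s.2.1 s.2.2)
  have hT : ∀ g, T g = g - ∑ s ∈ standardExponents a b α γ n,
      socleForm K a b α γ n (g * dualMon K a b α γ n s.1 s.2.1 s.2.2) •
        mon K s.1 s.2.1 s.2.2 := by
    intro g; simp [T]
  have hTI : ∀ g ∈ gorIdeal K a b α γ n, T g ∈ gorIdeal K a b α γ n := by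
    intro g hg
    rw [hT, Finset.sum_eq_zero, sub_zero]
    · exact hg
    · intro s _
      rw [socleForm_mul_eq_zero hγ hn hnb hg, zero_smul]
  have hmon : ∀ j i k, T (mon K i j k) ∈ gorIdeal K a b α γ n := by
    intro j
    induction j using Nat.strong_induction_on with
    | _ j ih =>
    intro i k
    by_cases hz : a ≤ i ∨ 3 ≤ k ∨ (n ≤ j ∧ (a ≤ i + α ∨ 3 ≤ k + γ))
    · exact hTI _ (mon_mem_gorIdeal hz)
    by_cases hj : b ≤ j
    · have h := hTI _ (mon_sub_mon_mem_gorIdeal (i := i) (k := k) hj)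
      rw [map_sub] at h
      exact (Submodule.sub_mem_iff_left _ (ih (j - b) (by omega) _ _)).mp h
    have hs : (i, j, k) ∈ standardExponents a b α γ n := by
      simp only [standardExponents, Finset.mem_filter, Finset.mem_product, Finset.mem_range]
      omega
    rw [hT, Finset.sum_eq_single_of_mem _ hs]
    · have : socleForm K a b α γ n (mon K i j k * dualMon K a b α γ n i j k) = 1 := by
        unfold dualMon
        split_ifs with h
        all_goals
          rw [mon_mul, socleForm_mon, if_pos]
          unfold IsSocleExponent
          omega
      rw [this, one_smul, sub_self]
      exact zero_mem _
    · rintro ⟨i', j', k'⟩ hs' hne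
      simp only [standardExponents, Finset.mem_filter, Finset.mem_product, Finset.mem_range] at hs'
      have hne' : ¬ (i' = i ∧ j' = j ∧ k' = k) := by
        rintro ⟨rfl, rfl, rfl⟩; exact hne rfl
      have : socleForm K a b α γ n (mon K i j k * dualMon K a b α γ n i' j' k') = 0 := by
        unfold dualMon
        split_ifs with h
        all_goals
          rw [mon_mul, socleForm_mon, if_neg]
          unfold IsSocleExponent
          omega
      rw [this, zero_smul]
  have h := mem_of_mon_mem (((gorIdeal K a b α γ n).restrictScalars K).comap T)
    (fun i j k => hmon j i k) f
  have h' : T f = f := by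
    rw [hT, Finset.sum_eq_zero, sub_zero]
    intro s _
    rw [hdual, zero_smul]
  simpa [h'] using h

end Duality

section Expansion

variable {Q : Type*} [CommRing Q] {x z : Q}

theorem pow_mul_add_pow_mul_sq (hz : z ^ 3 = 0) {N p t : ℕ} (h : p + N = t) :
    x ^ p * (x + z) ^ N * z ^ 2 = x ^ t * z ^ 2 := by
  subst h
  induction N generalizing p with
  | zero => simp
  | succ N ih =>
    have h1 := ih (p := p + 1)
    rw [show p + 1 + N = p + (N + 1) by ring] at h1
    rw [← h1]
    linear_combination x ^ p * (x + z) ^ N * hz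

theorem pow_mul_add_pow_mul_self (hz : z ^ 3 = 0) {N p t : ℕ} (h : p + N = t + 1) :
    x ^ p * (x + z) ^ N * z = x ^ (t + 1) * z + N * (x ^ t * z ^ 2) := by
  induction N generalizing p with
  | zero => simp [← h]
  | succ N ih =>
    have h1 := ih (p := p + 1) (by omega)
    have h2 := pow_mul_add_pow_mul_sq (x := x) hz (show p + N = t by omega)
    push_cast
    linear_combination h1 + h2

theorem pow_mul_add_pow (hz : z ^ 3 = 0) {N p t : ℕ} (h : p + N = t + 2) :
    x ^ p * (x + z) ^ N =
      x ^ (t + 2) + N * (x ^ (t + 1) * z) + (N.choose 2 : ℕ) * (x ^ t * z ^ 2) := by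
  induction N generalizing p with
  | zero => simp [← h]
  | succ N ih =>
    have h1 := ih (p := p + 1) (by omega)
    have h2 := pow_mul_add_pow_mul_self (x := x) hz (show p + N = t + 1 by omega)
    rw [Nat.choose_succ_succ' N 1, Nat.choose_one_right]
    push_cast
    linear_combination h1 + h2

theorem two_mul_choose_two (N : ℕ) : 2 * (N.choose 2 : ℤ) = N * N - N := by
  induction N with
  | zero => simp
  | succ N ih =>
    rw [Nat.choose_succ_succ' N 1, Nat.choose_one_right]
    push_cast
    linarith

theorem eq_zero_of_intCast_mul_eq_zero (K : Type*) [Field K] [CharZero K] [Algebra K Q]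
    {c : ℤ} {u : Q} (h : (c : Q) * u = 0) (hc : c ≠ 0) : u = 0 := by
  have h' : (c : K) • u = 0 := by rw [Algebra.smul_def, map_intCast, h]
  exact (smul_eq_zero.mp h').resolve_left (Int.cast_ne_zero.mpr hc)

theorem monomials_eq_zero (K : Type*) [Field K] [CharZero K] [Algebra K Q] {a b α γ n t : ℕ}
    (ha : 3 ≤ a) (hα2 : α + 1 ≤ a)
    (hγ1 : 1 ≤ γ) (hγ2 : γ ≤ 2) (hαγ : α + γ = b) (hn : 1 ≤ n) (hnb : n ≤ b)
    (han : a + n + 1 ≤ 2 * b) (ht : t + 1 = (a + n) / 2)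
    (hx : x ^ a = 0) (hz : z ^ 3 = 0) (hb : (x + z) ^ b = x ^ α * z ^ γ)
    (hxn : x ^ (a - α) * (x + z) ^ n = 0) (hzn : (x + z) ^ n * z ^ (3 - γ) = 0) :
    x ^ (t + 2) = 0 ∧ x ^ (t + 1) * z = 0 ∧ x ^ t * z ^ 2 = 0 := by
  have hxp : ∀ p, a ≤ p → x ^ p = 0 := fun p hp => pow_eq_zero_of_le hp hx
  have hxnp : ∀ p, a - α ≤ p → x ^ p * (x + z) ^ n = 0 := by
    intro p hp
    obtain ⟨q, rfl⟩ := Nat.exists_eq_add_of_le hp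
    linear_combination x ^ q * hxn
  have hzn2 : (x + z) ^ n * z ^ 2 = 0 := by
    obtain rfl | rfl : γ = 1 ∨ γ = 2 := by omega
    · exact hzn
    · linear_combination z * hzn
  have r0 : a - α + n ≤ t + 2 →
      x ^ (t + 2) + n * (x ^ (t + 1) * z) + (n.choose 2 : ℕ) * (x ^ t * z ^ 2) = 0 := fun h => by
    rw [← pow_mul_add_pow hz (show (t + 2 - n) + n = t + 2 by omega), hxnp _ (by omega)]
  have r1 : a - α + n ≤ t + 1 → x ^ (t + 1) * z + n * (x ^ t * z ^ 2) = 0 := fun h => by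
    rw [← pow_mul_add_pow_mul_self hz (show (t + 1 - n) + n = t + 1 by omega),
      hxnp _ (by omega), zero_mul]
  have r2 : n ≤ t → x ^ t * z ^ 2 = 0 := fun h => by
    rw [← pow_mul_add_pow_mul_sq hz (show (t - n) + n = t by omega), mul_assoc, hzn2, mul_zero]
  have rb : b = t + 2 → x ^ (t + 2) + b * (x ^ (t + 1) * z) +
      (b.choose 2 : ℕ) * (x ^ t * z ^ 2) = x ^ α * z ^ γ := fun h => by
    rw [← pow_mul_add_pow hz (show 0 + b = t + 2 by omega), pow_zero, one_mul, hb]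
  have cn := congrArg (Int.cast : ℤ → Q) (two_mul_choose_two n)
  have cb := congrArg (Int.cast : ℤ → Q) (two_mul_choose_two b)
  push_cast at cn cb
  set M0 := x ^ (t + 2) with hM0
  set M1 := x ^ (t + 1) * z with hM1
  set M2 := x ^ t * z ^ 2 with hM2
  obtain rfl | rfl : γ = 1 ∨ γ = 2 := by omega
  · by_cases hnt : n ≤ t
    · have h2 := r2 hnt
      by_cases hs : a - α + n ≤ t + 1
      · have h1 : M1 = 0 := by linear_combination r1 hs - n * h2
        exact ⟨by linear_combination r0 (by omega) - n * h1 - (n.choose 2 : ℕ) * h2, h1, h2⟩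
      · have hb' : b = t + 2 := by omega
        have hα : α = t + 1 := by omega
        have hr := rb hb'
        rw [hα, pow_one, ← hM1] at hr
        have h1 : M1 = 0 := by
          refine eq_zero_of_intCast_mul_eq_zero K (c := b - 1 - n) ?_ (by omega)
          push_cast
          linear_combination hr - r0 (by omega) + ((n.choose 2 : ℕ) - (b.choose 2 : ℕ)) * h2
        exact ⟨by linear_combination r0 (by omega) - n * h1 - (n.choose 2 : ℕ) * h2, h1, h2⟩
    · have hb' : b = t + 2 := by omega
      have hα : α = t + 1 := by omega
      have hbn : b = n + 1 := by omega
      have hr := rb hb'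
      rw [hα, pow_one, ← hM1, hbn, Nat.choose_succ_succ' n 1, Nat.choose_one_right] at hr
      push_cast at hr
      have h0 : M0 = 0 := hxp _ (by omega)
      have h2 : M2 = 0 := by
        refine eq_zero_of_intCast_mul_eq_zero K (c := n) ?_ (by omega)
        push_cast
        linear_combination hr - r0 (by omega)
      refine ⟨h0, eq_zero_of_intCast_mul_eq_zero K (c := n) ?_ (by omega), h2⟩
      push_cast
      linear_combination r0 (by omega) - h0 - (n.choose 2 : ℕ) * h2
  · rw [show 3 - 2 = 1 from rfl, pow_one] at hzn
    have r1' : n ≤ t + 1 → M1 + n * M2 = 0 := fun h => by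
      rw [hM1, hM2, ← pow_mul_add_pow_mul_self hz (show (t + 1 - n) + n = t + 1 by omega),
        mul_assoc, hzn, mul_zero]
    have hr : b = t + 2 → M0 + b * M1 + (b.choose 2 : ℕ) * M2 = M2 := fun h => by
      rw [rb h, show α = t by omega]
    have hbb : (b : ℤ) * b - b ≠ 2 := by
      have : (3 : ℤ) ≤ b := by omega
      nlinarith
    by_cases hnt : n ≤ t
    · have h2 := r2 hnt
      have h1 : M1 = 0 := by linear_combination r1' (by omega) - n * h2
      refine ⟨?_, h1, h2⟩
      by_cases hs : a - α + n ≤ t + 2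
      · linear_combination r0 hs - n * h1 - (n.choose 2 : ℕ) * h2
      · linear_combination hr (by omega) - b * h1 - ((b.choose 2 : ℕ) - 1) * h2
    have h0 : M0 = 0 := hxp _ (by omega)
    by_cases hnt1 : n = t + 1
    · have h1' := r1' hnt1.le
      have h2 : M2 = 0 := by
        by_cases hat : a ≤ t + 1
        · have h1 : M1 = 0 := by rw [hM1, hxp _ hat, zero_mul]
          refine eq_zero_of_intCast_mul_eq_zero K (c := n) ?_ (by omega)
          push_cast
          linear_combination h1' - h1
        · by_cases hb' : b = t + 2
          · refine eq_zero_of_intCast_mul_eq_zero K (c := b * b - b + 2) ?_ (by nlinarith)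
            have hbn : (b : Q) = n + 1 := by
              rw [show b = n + 1 by omega]; push_cast; rfl
            push_cast
            linear_combination 2 * h0 - 2 * hr hb' + 2 * b * h1' + M2 * cb + 2 * b * M2 * hbn
          · refine eq_zero_of_intCast_mul_eq_zero K (c := n * n + n) ?_ (by positivity)
            push_cast
            linear_combination 2 * h0 - 2 * r0 (by omega) + 2 * n * h1' + M2 * cn
      exact ⟨h0, by linear_combination h1' - n * h2, h2⟩
    · have h1 : M1 = 0 := by rw [hM1, hxp _ (by omega), zero_mul]
      refine ⟨h0, h1, eq_zero_of_intCast_mul_eq_zero K (c := b * b - b - 2) ?_ (by omega)⟩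
      push_cast
      linear_combination 2 * hr (by omega) - 2 * h0 - 2 * b * h1 - M2 * cb

theorem pow_mul_add_pow_mul_pow_eq_zero (hz : z ^ 3 = 0) {t : ℕ} (h0 : x ^ (t + 2) = 0)
    (h1 : x ^ (t + 1) * z = 0) (h2 : x ^ t * z ^ 2 = 0) {i j k : ℕ} (h : t + 2 ≤ i + j + k) :
    x ^ i * (x + z) ^ j * z ^ k = 0 := by
  induction j generalizing i k with
  | zero =>
    have hle {p q : ℕ} (hp : p ≤ i) (hq : q ≤ k) (hpq : x ^ p * z ^ q = 0) :
        x ^ i * (x + z) ^ 0 * z ^ k = 0 := by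
      rw [pow_zero, mul_one]
      exact eq_zero_of_zero_dvd (hpq ▸ mul_dvd_mul (pow_dvd_pow _ hp) (pow_dvd_pow _ hq))
    by_cases hk : 3 ≤ k
    · exact hle (p := 0) (Nat.zero_le _) hk (by simp [hz])
    · obtain rfl | rfl | rfl : k = 0 ∨ k = 1 ∨ k = 2 := by omega
      · exact hle (p := t + 2) (q := 0) (by omega) le_rfl (by simp [h0])
      · exact hle (p := t + 1) (q := 1) (by omega) le_rfl (by simp [h1])
      · exact hle (p := t) (by omega) le_rfl h2
  | succ j ih =>
    linear_combination ih (i := i + 1) (k := k) (by omega) + ih (i := i) (k := k + 1) (by omega)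

end Expansion

section Lefschetz

attribute [local instance] MvPolynomial.gradedAlgebra

variable {K : Type*} [Field K] {a b α γ n : ℕ}

theorem exists_isHomogeneous_sub_mul_mem {σ : Type*} {I : Ideal (MvPolynomial σ K)}
    (hI : I.IsHomogeneous (homogeneousSubmodule σ K)) {L w : MvPolynomial σ K}
    (hL : L.IsHomogeneous 1) {i : ℕ} (hw : w.IsHomogeneous (i + 1))
    (h : w ∈ I ⊔ Ideal.span {L}) : ∃ u, u.IsHomogeneous i ∧ w - L * u ∈ I := by
  obtain ⟨f, hf, g, hg, rfl⟩ := Submodule.mem_sup.mp h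
  obtain ⟨g, rfl⟩ := Ideal.mem_span_singleton.mp hg
  refine ⟨DirectSum.decompose (homogeneousSubmodule σ K) g i,
    (DirectSum.decompose (homogeneousSubmodule σ K) g i).2, ?_⟩
  have h1 := DirectSum.coe_decompose_mul_add_of_left_mem (homogeneousSubmodule σ K) (j := i)
    (b := g) hL
  have h2 := DirectSum.decompose_of_mem_same (homogeneousSubmodule σ K) hw
  rw [DirectSum.decompose_add, DirectSum.add_apply, Submodule.coe_add, add_comm i 1, h1] at h2
  rw [← h2, add_sub_cancel_right]
  exact hI _ hf

theorem isHomogeneous_gorIdeal (hαγ : α + γ = b) :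
    (gorIdeal K a b α γ n).IsHomogeneous (homogeneousSubmodule (Fin 3) K) := by
  refine Ideal.homogeneous_span _ _ fun f hf => ?_
  simp only [Set.mem_insert_iff, Set.mem_singleton_iff] at hf
  rcases hf with rfl | rfl | rfl | rfl | rfl
  · exact ⟨_, isHomogeneous_X_pow _ _⟩
  · exact ⟨b, (isHomogeneous_X_pow _ _).sub
      (hαγ ▸ (isHomogeneous_X_pow _ _).mul (isHomogeneous_X_pow _ _))⟩
  · exact ⟨_, isHomogeneous_X_pow _ _⟩
  · exact ⟨_, (isHomogeneous_X_pow _ _).mul (isHomogeneous_X_pow _ _)⟩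
  · exact ⟨_, (isHomogeneous_X_pow _ _).mul (isHomogeneous_X_pow _ _)⟩

/-- The Lefschetz element `x + z - y`. -/
noncomputable def lefschetzForm (K : Type*) [Field K] : MvPolynomial (Fin 3) K :=
  X 0 + X 2 - X 1

theorem isHomogeneous_lefschetzForm : (lefschetzForm K).IsHomogeneous 1 :=
  ((isHomogeneous_X _ _).add (isHomogeneous_X _ _)).sub (isHomogeneous_X _ _)

theorem mon_mem_gorIdeal_sup_span [CharZero K]
    (ha : 3 ≤ a) (hα2 : α + 1 ≤ a)
    (hγ1 : 1 ≤ γ) (hγ2 : γ ≤ 2) (hαγ : α + γ = b) (hn : 1 ≤ n) (hnb : n ≤ b)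
    (han : a + n + 1 ≤ 2 * b) {i j k : ℕ} (h : (a + n) / 2 + 1 ≤ i + j + k) :
    mon K i j k ∈ gorIdeal K a b α γ n ⊔ Ideal.span {lefschetzForm K} := by
  set J := gorIdeal K a b α γ n ⊔ Ideal.span {lefschetzForm K} with hJ
  let q := Ideal.Quotient.mk J
  have hq (f : MvPolynomial (Fin 3) K) (hf : f ∈ ({(X 0 : MvPolynomial (Fin 3) K) ^ a,
      X 1 ^ b - X 0 ^ α * X 2 ^ γ, X 2 ^ 3,
      X 0 ^ (a - α) * X 1 ^ n, X 1 ^ n * X 2 ^ (3 - γ)} : Set (MvPolynomial (Fin 3) K))) :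
      q f = 0 :=
    Ideal.Quotient.eq_zero_iff_mem.mpr (Ideal.mem_sup_left (Ideal.subset_span hf))
  have hy : q (X 1) = q (X 0) + q (X 2) := by
    have : q (lefschetzForm K) = 0 := Ideal.Quotient.eq_zero_iff_mem.mpr
      (Ideal.mem_sup_right (Ideal.mem_span_singleton_self _))
    rw [lefschetzForm, map_sub, map_add] at this
    exact (sub_eq_zero.mp this).symm
  have e1 := hq (X 0 ^ a) (by simp)
  have e2 := hq (X 1 ^ b - X 0 ^ α * X 2 ^ γ) (by simp)
  have e3 := hq (X 2 ^ 3) (by simp)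
  have e4 := hq (X 0 ^ (a - α) * X 1 ^ n) (by simp)
  have e5 := hq (X 1 ^ n * X 2 ^ (3 - γ)) (by simp)
  simp only [map_mul, map_pow, map_sub, hy] at e1 e2 e3 e4 e5
  have ht : (a + n) / 2 - 1 + 1 = (a + n) / 2 := by omega
  obtain ⟨h0, h1, h2⟩ := monomials_eq_zero K ha hα2 hγ1 hγ2 hαγ hn hnb han ht e1 e3
    (sub_eq_zero.mp e2) e4 e5
  rw [← Ideal.Quotient.eq_zero_iff_mem]
  change q _ = 0
  simp only [mon, map_mul, map_pow, hy]
  exact pow_mul_add_pow_mul_pow_eq_zero e3 h0 h1 h2 (by omega)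

theorem mem_gorIdeal_sup_span [CharZero K]
    (ha : 3 ≤ a) (hα2 : α + 1 ≤ a)
    (hγ1 : 1 ≤ γ) (hγ2 : γ ≤ 2) (hαγ : α + γ = b) (hn : 1 ≤ n) (hnb : n ≤ b)
    (han : a + n + 1 ≤ 2 * b) {D : ℕ} (hD : (a + n) / 2 + 1 ≤ D)
    {f : MvPolynomial (Fin 3) K} (hf : f.IsHomogeneous D) :
    f ∈ gorIdeal K a b α γ n ⊔ Ideal.span {lefschetzForm K} := by
  rw [← f.support_sum_monomial_coeff]
  refine Ideal.sum_mem _ fun s hs => ?_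
  have h := hf (mem_support_iff.mp hs)
  change Finsupp.weight (fun _ => 1) s = D at h
  rw [← Finsupp.degree_eq_weight_one, Finsupp.degree_eq_sum, Fin.sum_univ_three] at h
  rw [monomial_eq_smul_mon, smul_eq_C_mul]
  exact Ideal.mul_mem_left _ _
    (mon_mem_gorIdeal_sup_span ha hα2 hγ1 hγ2 hαγ hn hnb han (by omega))

theorem mem_gorIdeal_of_lefschetzForm_mul_mem [CharZero K]
    (ha : 3 ≤ a) (hα : 1 ≤ α) (hα2 : α + 1 ≤ a)
    (hγ1 : 1 ≤ γ) (hγ2 : γ ≤ 2) (hαγ : α + γ = b) (hn : 1 ≤ n) (hnb : n ≤ b)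
    (han : a + n + 1 ≤ 2 * b) {D : ℕ} (hD : D + (a + n) / 2 + 1 ≤ a + n)
    {f : MvPolynomial (Fin 3) K} (hf : f.IsHomogeneous D)
    (hLf : lefschetzForm K * f ∈ gorIdeal K a b α γ n) : f ∈ gorIdeal K a b α γ n := by
  refine mem_gorIdeal_of_socleForm_eq_zero hα hγ1 hγ2 hn hnb fun i j k => ?_
  by_cases hdeg : D + (i + j + k) = a + n
  · obtain ⟨p, hp, q, hq, hpq⟩ := Submodule.mem_sup.mp
      (mon_mem_gorIdeal_sup_span (K := K) (i := i) (j := j) (k := k)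
        ha hα2 hγ1 hγ2 hαγ hn hnb han (by omega))
    obtain ⟨r, rfl⟩ := Ideal.mem_span_singleton.mp hq
    rw [← hpq, show f * (p + lefschetzForm K * r) = p * f + lefschetzForm K * f * r by ring,
      map_add, socleForm_mul_eq_zero hγ1 hn hnb hp, socleForm_mul_eq_zero hγ1 hn hnb hLf, add_zero]
  · exact socleForm_eq_zero_of_isHomogeneous hαγ hdeg (hf.mul (isHomogeneous_mon i j k))

theorem hasWLP_gorIdeal [CharZero K]
    (ha : 3 ≤ a) (hα : 1 ≤ α) (hα2 : α + 1 ≤ a)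
    (hγ1 : 1 ≤ γ) (hγ2 : γ ≤ 2) (hαγ : α + γ = b) (hn : 1 ≤ n) (hnb : n ≤ b)
    (han : a + n + 1 ≤ 2 * b) : hasWLP K (gorIdeal K a b α γ n) := by
  refine ⟨lefschetzForm K, isHomogeneous_lefschetzForm, fun i => ?_⟩
  by_cases hi : (a + n) / 2 ≤ i
  · right
    rintro _ ⟨w, hw, rfl⟩
    obtain ⟨u, hu, hwu⟩ := exists_isHomogeneous_sub_mul_mem (isHomogeneous_gorIdeal hαγ)
      isHomogeneous_lefschetzForm hw
      (mem_gorIdeal_sup_span ha hα2 hγ1 hγ2 hαγ hn hnb han (by omega) hw)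
    refine ⟨_, ⟨u, hu, rfl⟩, ?_⟩
    change Ideal.Quotient.mk _ _ * Ideal.Quotient.mk _ u = Ideal.Quotient.mk _ w
    rw [← map_mul, eq_comm, Ideal.Quotient.eq]
    exact hwu
  · left
    rintro _ ⟨u, hu, rfl⟩ _ ⟨v, hv, rfl⟩ h
    change Ideal.Quotient.mk _ _ * Ideal.Quotient.mk _ u =
      Ideal.Quotient.mk _ _ * Ideal.Quotient.mk _ v at h
    rw [← map_mul, ← map_mul, Ideal.Quotient.eq, ← mul_sub] at h
    exact Ideal.Quotient.eq.mpr (mem_gorIdeal_of_lefschetzForm_mul_mem ha hα hα2 hγ1 hγ2 hαγ hn hnb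
      han (by omega) (IsHomogeneous.sub hu hv) h)

end Lefschetz

theorem stmt_17 (K : Type*) [Field K] [CharZero K] (a b α β γ : ℕ)
    (ha : 3 ≤ a) (hab : (a : ℤ) ≤ 2 * b - 2)
    (hα1 : 1 ≤ α) (hα2 : α ≤ a - 1)
    (hγ1 : 1 ≤ γ) (hγ2 : γ ≤ 2)
    (hαγ : α + γ = b)
    (hβ1 : (a : ℤ) - b + 1 ≤ (β : ℤ)) (hβ2 : β ≤ b - 1) :
    hasWLP K (Ideal.span {(X 0 : MvPolynomial (Fin 3) K) ^ a,
      X 1 ^ b - X 0 ^ α * X 2 ^ γ, X 2 ^ 3,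
      X 0 ^ (a - α) * X 1 ^ (b - β), X 1 ^ (b - β) * X 2 ^ (3 - γ)}) := by
  exact hasWLP_gorIdeal ha hα1 (by omega) hγ1 hγ2 hαγ (by omega) (by omega) (by omega)
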